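/- Let n ∈ ℕ⁺ and let F be a field of characteristic different from 2. If F is n-effective, then 2ⁿ ≤ p(F) ≤ 2ⁿ + 1. -/

import Mathlib

open scoped Pointwise

universe u

namespace SosPaper

/-- The set of sums of `k` squares in a commutative ring. -/
def sumSq (A : Type*) [CommRing A] (k : ℕ) : Set A :=
  {x | ∃ f : Fin k → A, x = ∑ i, f i ^ 2}

/-- The set of sums of squares in a commutative ring. -/
def sums (A : Type*) [CommRing A] : Set A := ⋃ k, sumSq A k

/-- The Pythagoras number of a commutative ring, as an extended natural number:
the least `k` such that every sum of squares is a sum of `k` squares. -/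
noncomputable def pyth (A : Type*) [CommRing A] : ℕ∞ :=
  sInf ((fun k : ℕ => (k : ℕ∞)) '' {k : ℕ | sums A ⊆ sumSq A k})

/-- The level of a commutative ring: the least `k` such that `-1` is a sum of
`k` squares. -/
noncomputable def level (A : Type*) [CommRing A] : ℕ∞ :=
  sInf ((fun k : ℕ => (k : ℕ∞)) '' {k : ℕ | (-1 : A) ∈ sumSq A k})

/-- A subring `H` of a field (or commutative ring) `A` has `A` as its field of
fractions: every element of `A` is a quotient of two elements of `H`. -/
def IsFractionSubring {A : Type*} [CommRing A] (H : Subring A) : Prop :=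
  ∀ x : A, ∃ a b : H, b ≠ 0 ∧ x * b = a

/-- The invariant `p*(H)`: the least `k` such that every unit of `H` that is a
sum of squares in the ambient ring is a sum of `k` squares in the ambient ring. -/
noncomputable def pstar {A : Type*} [CommRing A] (H : Subring A) : ℕ∞ :=
  sInf ((fun k : ℕ => (k : ℕ∞)) '' {k : ℕ | ∀ h : H, IsUnit h → (h : A) ∈ sums A → (h : A) ∈ sumSq A k})

/-- A commutative ring is semilocal if it has only finitely many maximal ideals. -/
def Semilocal (A : Type*) [CommRing A] : Prop := {I : Ideal A | I.IsMaximal}.Finite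

/-- The `H`-submodule `f·H` of the ambient ring, as a set. -/
def mulSet {A : Type*} [CommRing A] (H : Subring A) (f : A) : Set A :=
  {x | ∃ h ∈ H, x = f * h}

/-- A subring `H` of a field `F` (with fraction field `F`) is square-effective if
every sum of two squares of elements of `F` can be rewritten as `g₁² + g₂²` with
`f₁H + f₂H = g₁H ⊇ g₂H`. -/
def SquareEffective {A : Type*} [CommRing A] (H : Subring A) : Prop :=
  ∀ f₁ f₂ : A, ∃ g₁ g₂ : A, f₁ ^ 2 + f₂ ^ 2 = g₁ ^ 2 + g₂ ^ 2 ∧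
    mulSet H f₁ + mulSet H f₂ = mulSet H g₁ ∧ mulSet H g₂ ⊆ mulSet H g₁

/-- The two defining conditions for a (semilocal Bézout) domain `H` to be
square-effective of order `n`:
`1 + Σ_{2ⁿ−1} H² ⊆ H^×` and `(1 + Σ_{2ⁿ} H²) ∩ Jac(H) ≠ ∅`. -/
def SqEffOrder {A : Type*} [CommRing A] (H : Subring A) (n : ℕ) : Prop :=
  (∀ x : H, x ∈ sumSq H (2 ^ n - 1) → IsUnit (1 + x)) ∧
  ∃ x : H, x ∈ sumSq H (2 ^ n) ∧ 1 + x ∈ Ideal.jacobson (⊥ : Ideal H)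

/-- A field `F` is `n`-effective if it has a semilocal Bézout subring `H` with
fraction field `F` which is square-effective of order `n` and with `p*(H) ≤ 2ⁿ`. -/
def IsNEffective (n : ℕ) (F : Type*) [Field F] : Prop :=
  ∃ H : Subring F, IsFractionSubring H ∧ Semilocal H ∧ IsBezout H ∧
    SqEffOrder H n ∧ pstar H ≤ ((2 ^ n : ℕ) : ℕ∞)

/-- A subring `H` of `F` characterises sums of `k` squares in `F` if every unit
of `H` which is a sum of squares in `F` and whose residue modulo every maximal
ideal of `H` is a sum of `k` squares is itself a sum of `k` squares in `F`. -/
def Characterises {A : Type*} [CommRing A] (H : Subring A) (k : ℕ) : Prop :=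
  ∀ h : H, IsUnit h → (h : A) ∈ sums A →
    (∀ m : Ideal H, m.IsMaximal → Ideal.Quotient.mk m h ∈ sumSq (H ⧸ m) k) →
    (h : A) ∈ sumSq A k

/-- A function field in one variable over `K`: a finitely generated field
extension of transcendence degree 1, equivalently a finite extension of a
subfield `K(x)` with `x` transcendental over `K`. -/
def IsFunctionFieldOneVar (K F : Type*) [Field K] [Field F] [Algebra K F] : Prop :=
  ∃ x : F, Transcendental K x ∧ FiniteDimensional (IntermediateField.adjoin K {x}) F

/-- A `𝒫ₙ`-field: `p(K(X)) ≤ 2^{n+1}` and every function field in one variable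
over `K` with Pythagoras number `> 2^{n+1}` is `(n+1)`-effective. -/
def IsPnField (n : ℕ) (K : Type u) [Field K] : Prop :=
  pyth (RatFunc K) ≤ ((2 ^ (n + 1) : ℕ) : ℕ∞) ∧
  ∀ (F : Type u) [Field F] [Algebra K F], IsFunctionFieldOneVar K F →
    ((2 ^ (n + 1) : ℕ) : ℕ∞) < pyth F → IsNEffective (n + 1) F


theorem sumSq_mono {A : Type*} [CommRing A] {k l : ℕ} (h : k ≤ l) :
    sumSq A k ⊆ sumSq A l := by
  rintro _ ⟨f, rfl⟩
  obtain ⟨m, rfl⟩ := Nat.exists_eq_add_of_le h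
  exact ⟨Fin.append f 0, by simp [Fin.sum_univ_add]⟩

theorem sumSq_subset_sums {A : Type*} [CommRing A] (k : ℕ) : sumSq A k ⊆ sums A :=
  Set.subset_iUnion _ k

theorem sq_mul_mem_sumSq {A : Type*} [CommRing A] {k : ℕ} {x : A} (e : A)
    (hx : x ∈ sumSq A k) : e ^ 2 * x ∈ sumSq A k := by
  obtain ⟨f, rfl⟩ := hx
  exact ⟨fun i => e * f i, by simp [mul_pow, Finset.mul_sum]⟩

theorem sq_add_mem_sumSq {A : Type*} [CommRing A] {k : ℕ} {x : A} (e : A)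
    (hx : x ∈ sumSq A k) : e ^ 2 + x ∈ sumSq A (k + 1) := by
  obtain ⟨f, rfl⟩ := hx
  exact ⟨Fin.cons e f, by simp [Fin.sum_univ_succ]⟩

theorem mem_sumSq_of_pstar_le {A : Type*} [CommRing A] {H : Subring A} {N : ℕ}
    (hN : pstar H ≤ N) {h : H} (hu : IsUnit h) (hs : (h : A) ∈ sums A) :
    (h : A) ∈ sumSq A N := by
  have hne : ((fun k : ℕ => (k : ℕ∞)) '' {k : ℕ | ∀ h : H, IsUnit h → (h : A) ∈ sums A →
      (h : A) ∈ sumSq A k}).Nonempty := by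
    by_contra! hempty
    rw [pstar, hempty, sInf_empty] at hN
    exact ENat.natCast_ne_top N (top_le_iff.1 hN)
  obtain ⟨k, hk, hk'⟩ := csInf_mem hne
  have hkN : k ≤ N := by
    have : (k : ℕ∞) ≤ N := hk'.trans_le hN
    exact_mod_cast this
  exact sumSq_mono hkN (hk h hu hs)

/-- Over a Bézout subring with fraction field `F`, every nonzero finite family in `F` is a
multiple of a unimodular family. -/
theorem exists_unimodular {F : Type*} [Field F] {H : Subring F} (hfrac : IsFractionSubring H)
    [IsBezout H] {ι : Type*} [Fintype ι] {a : ι → F} (ha : a ≠ 0) :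
    ∃ (e : F) (v c : ι → H), (∀ i, a i = e * v i) ∧ ∑ i, c i * v i = 1 := by
  classical
  choose p q hq hpq using fun i => hfrac (a i)
  set d : H := ∏ i, q i with hd
  have hd0 : d ≠ 0 := Finset.prod_ne_zero_iff.2 fun i _ => hq i
  have hd0' : (d : F) ≠ 0 := by simpa using hd0
  have hh : ∀ i, ∃ h : H, a i * d = h := fun i => by
    refine ⟨p i * ∏ j ∈ Finset.univ.erase i, q j, ?_⟩
    rw [hd, ← Finset.mul_prod_erase _ _ (Finset.mem_univ i)]
    push_cast
    rw [← hpq i, mul_assoc]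
  choose h hh using hh
  obtain ⟨g, hg⟩ := IsBezout.isPrincipal_of_FG (Ideal.span (Set.range h))
    ⟨Finset.univ.image h, by simp⟩
  have hg' : Ideal.span (Set.range h) = Ideal.span {g} := hg
  have hdvd : ∀ i, ∃ v, h i = g * v := fun i => by
    have : h i ∈ Ideal.span {g} := hg' ▸ Ideal.subset_span ⟨i, rfl⟩
    exact Ideal.mem_span_singleton.1 this
  choose v hv using hdvd
  have hgm : g ∈ Ideal.span (Set.range h) := hg' ▸ Ideal.mem_span_singleton_self g
  obtain ⟨c, hc⟩ := Ideal.mem_span_range_iff_exists_fun.1 hgm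
  have hav : ∀ i, a i = g / d * v i := fun i => by
    have : a i * d = g * v i := by rw [hh i, hv i]; rfl
    field_simp
    exact this
  have hg0 : g ≠ 0 := by
    rintro rfl
    exact ha (funext fun i => by simp [hav i])
  refine ⟨g / d, v, c, hav, mul_left_cancel₀ hg0 ?_⟩
  rw [Finset.mul_sum, mul_one]
  refine Eq.trans (Finset.sum_congr rfl fun i _ => ?_) hc
  rw [hv i]; ring

theorem le_of_sums_subset {F : Type*} [Field F] {H : Subring F} (hfrac : IsFractionSubring H)
    [IsBezout H] {n : ℕ} (heff : SqEffOrder H n) {k : ℕ} (hk : sums F ⊆ sumSq F k) :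
    2 ^ n ≤ k := by
  by_contra! hlt
  obtain ⟨hunit, x, ⟨y, hy⟩, hjac⟩ := heff
  obtain ⟨a, ha⟩ : (x : F) ∈ sumSq F k :=
    hk (sumSq_subset_sums (2 ^ n) ⟨fun i => y i, by simp [hy]⟩)
  have hne : (Fin.cons 1 a : Fin (k + 1) → F) ≠ 0 := fun h => by
    simpa using congrFun h 0
  obtain ⟨e, v, c, hav, hcv⟩ := exists_unimodular hfrac hne
  have h0 : e * v 0 = 1 := by simpa using (hav 0).symm
  have hsum : ∑ i, v i ^ 2 = v 0 ^ 2 * (1 + x) := by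
    apply Subtype.ext
    have hx : (1 + x : F) = e ^ 2 * ∑ i, (v i : F) ^ 2 := by
      rw [ha, Finset.mul_sum, Fin.sum_univ_succ]
      simp only [← mul_pow, ← hav]
      simp
    push_cast
    rw [hx]
    linear_combination (-(e * v 0) - 1) * (∑ i, (v i : F) ^ 2) * h0
  obtain ⟨m, hm⟩ := Ideal.exists_maximal H
  have hmem : ∑ i, v i ^ 2 ∈ m := by
    rw [hsum]
    exact m.mul_mem_left _ ((Ideal.mem_sInf.1 hjac) ⟨bot_le, hm⟩)
  obtain ⟨i, hi⟩ : ∃ i, v i ∉ m := by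
    by_contra! hall
    exact hm.ne_top ((Ideal.eq_top_iff_one m).2
      (hcv ▸ m.sum_mem fun i _ => m.mul_mem_left _ (hall i)))
  obtain ⟨u, t, ht, hu⟩ := hm.exists_inv hi
  have hsq : ∑ j, (u * v (i.succAbove j)) ^ 2 ∈ sumSq H (2 ^ n - 1) :=
    sumSq_mono (Nat.le_sub_one_of_lt hlt) ⟨_, rfl⟩
  refine hm.ne_top (m.eq_top_of_isUnit_mem ?_ (hunit _ hsq))
  have key : 1 + ∑ j, (u * v (i.succAbove j)) ^ 2
      = u ^ 2 * ∑ i, v i ^ 2 + (1 + u * v i) * t := by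
    rw [Fin.sum_univ_succAbove _ i]
    simp only [mul_pow, ← Finset.mul_sum]
    linear_combination (-1 - u * v i) * hu
  rw [key]
  exact m.add_mem (m.mul_mem_left _ hmem) (m.mul_mem_left _ ht)

/-- In a semilocal domain in which `2` is a unit, a sum of squares of a unimodular family
differs from a suitable square by a unit which is again a sum of squares. -/
theorem exists_isUnit_sub_sq {H : Type*} [CommRing H] (hsl : Semilocal H)
    (h2 : IsUnit (2 : H)) {k : ℕ} {v c : Fin k → H} (hcv : ∑ i, c i * v i = 1) :
    ∃ b : H, IsUnit (∑ i, v i ^ 2 - b ^ 2) ∧ ∑ i, v i ^ 2 - b ^ 2 ∈ sumSq H k := by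
  classical
  set s := ∑ i, v i ^ 2 with hs
  have : Finite (MaximalSpectrum H) :=
    @Finite.of_injective _ {I : Ideal H | I.IsMaximal} hsl.to_subtype
      (fun m => ⟨m.asIdeal, m.isMaximal⟩) fun m m' h => by
        ext1; simpa using h
  have hi : ∀ m : MaximalSpectrum H, ∃ i, v i ∉ m.asIdeal := fun m => by
    by_contra! hall
    exact m.isMaximal.ne_top ((Ideal.eq_top_iff_one _).2
      (hcv ▸ Ideal.sum_mem _ fun i _ => Ideal.mul_mem_left _ _ (hall i)))
  choose ix hix using hi
  have hcop : Pairwise fun m m' : MaximalSpectrum H => IsCoprime m.asIdeal m'.asIdeal :=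
    fun m m' hne => Ideal.isCoprime_iff_sup_eq.2 <| Ideal.IsMaximal.coprime_of_ne
      m.isMaximal m'.isMaximal fun h => hne (MaximalSpectrum.ext h)
  have hcrt : ∀ i, ∃ w : H, ∀ m : MaximalSpectrum H,
      w - (if s ∈ m.asIdeal ∧ i = ix m then 1 else 0) ∈ m.asIdeal := fun i =>
    Ideal.exists_forall_sub_mem_ideal hcop _
  choose w hw using hcrt
  have hmk : ∀ (m : MaximalSpectrum H) i, Ideal.Quotient.mk m.asIdeal (w i) =
      if s ∈ m.asIdeal ∧ i = ix m then 1 else 0 := fun m i => by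
    rw [Ideal.Quotient.eq.2 (hw i m)]
    split_ifs <;> simp
  have isUnit_of : ∀ r : H, (∀ m : MaximalSpectrum H, Ideal.Quotient.mk m.asIdeal r ≠ 0) →
      IsUnit r := fun r hr => by
    by_contra hnu
    obtain ⟨m, hm, hrm⟩ := exists_max_ideal_of_mem_nonunits hnu
    exact hr ⟨m, hm⟩ (Ideal.Quotient.eq_zero_iff_mem.2 hrm)
  have h2m : ∀ m : MaximalSpectrum H, (2 : H ⧸ m.asIdeal) ≠ 0 := fun m => by
    have := m.isMaximal
    have h := (h2.map (Ideal.Quotient.mk m.asIdeal)).ne_zero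
    rwa [map_ofNat] at h
  have hden : IsUnit (1 + ∑ i, w i ^ 2) := isUnit_of _ fun m => by
    have := m.isMaximal
    by_cases hsm : s ∈ m.asIdeal
    · simpa [hmk, hsm, ite_pow, one_add_one_eq_two] using h2m m
    · simp [hmk, hsm]
  obtain ⟨z, hz⟩ := hden.exists_right_inv
  set b := 2 * (∑ i, v i * w i) * z with hb
  have hbd : b * (1 + ∑ i, w i ^ 2) = 2 * ∑ i, v i * w i := by
    rw [hb]; linear_combination 2 * (∑ i, v i * w i) * hz
  refine ⟨b, isUnit_of _ fun m => ?_, fun i => v i - b * w i, ?_⟩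
  · have := m.isMaximal
    have hbm := congrArg (Ideal.Quotient.mk m.asIdeal) hbd
    rw [map_sub, map_pow]
    by_cases hsm : s ∈ m.asIdeal
    · have hv : Ideal.Quotient.mk m.asIdeal b = Ideal.Quotient.mk m.asIdeal (v (ix m)) := by
        simp [hmk, hsm, ite_pow, one_add_one_eq_two] at hbm
        exact mul_right_cancel₀ (h2m m) (by rw [hbm, map_ofNat, mul_comm])
      rw [Ideal.Quotient.eq_zero_iff_mem.2 hsm, hv, zero_sub, neg_ne_zero]
      exact pow_ne_zero 2 fun h => hix m (Ideal.Quotient.eq_zero_iff_mem.1 h)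
    · have hv : Ideal.Quotient.mk m.asIdeal b = 0 := by
        simpa [hmk, hsm] using hbm
      rw [hv]
      simpa [Ideal.Quotient.eq_zero_iff_mem] using hsm
  · have : ∑ i, (v i - b * w i) ^ 2 =
        s - 2 * b * ∑ i, v i * w i + b ^ 2 * ∑ i, w i ^ 2 := by
      rw [hs, Finset.mul_sum, Finset.mul_sum, ← Finset.sum_sub_distrib,
        ← Finset.sum_add_distrib]
      exact Finset.sum_congr rfl fun i _ => by ring
    rw [this]
    linear_combination -b * hbd

theorem sums_subset_sumSq_succ {F : Type*} [Field F] {H : Subring F}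
    (hfrac : IsFractionSubring H) (hsl : Semilocal H) [IsBezout H] (h2 : IsUnit (2 : H))
    {N : ℕ} (hN : pstar H ≤ N) : sums F ⊆ sumSq F (N + 1) := by
  intro x hx
  obtain ⟨k, a, rfl⟩ := Set.mem_iUnion.1 hx
  by_cases ha : a = 0
  · exact ⟨0, by simp [ha]⟩
  obtain ⟨e, v, c, hav, hcv⟩ := exists_unimodular hfrac ha
  obtain ⟨b, hu, r, hr⟩ := exists_isUnit_sub_sq hsl h2 hcv
  have hmem := mem_sumSq_of_pstar_le hN hu
    (sumSq_subset_sums k ⟨fun i => r i, by rw [hr]; simp⟩)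
  have h := sq_mul_mem_sumSq e (sq_add_mem_sumSq (b : F) hmem)
  convert h using 1
  push_cast
  simp only [hav, mul_pow, ← Finset.mul_sum]
  ring

theorem statement12 (n : ℕ) (hn : 0 < n) {F : Type*} [Field F]
    (hchar : ringChar F ≠ 2) (heff : IsNEffective n F) :
    ((2 ^ n : ℕ) : ℕ∞) ≤ pyth F ∧ pyth F ≤ ((2 ^ n : ℕ) : ℕ∞) + 1 := by
  obtain ⟨H, hfrac, hsl, hbez, hsq, hN⟩ := heff
  have hone : (1 : H) ∈ sumSq H (2 ^ n - 1) :=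
    sumSq_mono (Nat.le_sub_one_of_lt (Nat.one_lt_two_pow hn.ne')) ⟨fun _ : Fin 1 => 1, by simp⟩
  have h2 : IsUnit (2 : H) := one_add_one_eq_two (R := H) ▸ hsq.1 1 hone
  constructor
  · refine le_sInf ?_
    rintro _ ⟨k, hk, rfl⟩
    exact Nat.cast_le.2 (le_of_sums_subset hfrac hsq hk)
  · exact sInf_le ⟨2 ^ n + 1, sums_subset_sumSq_succ hfrac hsl h2 hN, by push_cast; rfl⟩

end SosPaper
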